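/- arXiv:1410.6916 — 4 statements merged into one kernel-verified Lean document; each statement's English description precedes it below -/
import Mathlib

section
/- Let n be a positive integer with 2 dividing n(n+1)/2, and let 1 < p_1 ≤ p_2 be integers with p_1+p_2 = n. Then there exists an equitable partition of [n] implementing (p_1,p_2) if and only if Σ_{i=1}^{p_1} (n−i+1) ≥ s^{n,2}. -/
open Finset

/-- `s^{n,k} = (n(n+1)/2)/k`. -/
def magicConst (n k : ℕ) : ℕ := (n * (n + 1) / 2) / k

/-- `A` is a partition of `[n] = {1,…,n}` into `k` (indexed) parts. -/
def IsPartitionOn (n : ℕ) {k : ℕ} (A : Fin k → Finset ℕ) : Prop :=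
  (∀ i j : Fin k, i ≠ j → Disjoint (A i) (A j)) ∧
    Finset.univ.biUnion A = Finset.Icc 1 n

/-- The partition `A` of `[n]` implements the sequence of sizes `p` (up to reindexing). -/
def Implements (n : ℕ) {k : ℕ} (A : Fin k → Finset ℕ) (p : Fin k → ℕ) : Prop :=
  IsPartitionOn n A ∧ ∃ e : Equiv.Perm (Fin k), ∀ i, (A (e i)).card = p i

/-- Every part of the partition has sum `s^{n,k}`. -/
def Equitable (n : ℕ) {k : ℕ} (A : Fin k → Finset ℕ) : Prop :=
  ∀ i, (A i).sum id = magicConst n k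

/-- `d(A) = Σ_i (S(A_i) − s^{n,k})²`. -/
def dVal (n : ℕ) {k : ℕ} (A : Fin k → Finset ℕ) : ℤ :=
  ∑ i : Fin k, ((((A i).sum id : ℕ) : ℤ) - (magicConst n k : ℤ)) ^ 2

/-- A partition implementing `p` minimizing `d` among all partitions implementing `p`. -/
def MinimalPartition (n : ℕ) {k : ℕ} (A : Fin k → Finset ℕ) (p : Fin k → ℕ) : Prop :=
  Implements n A p ∧ ∀ B : Fin k → Finset ℕ, Implements n B p → dVal n A ≤ dVal n B

/-- Condition (★): `Σ_{i=1}^{P_j} (n−i+1) ≥ j·s^{n,k}` for all `j = 1,…,k`,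
where `P_j = p_1 + ⋯ + p_j`. -/
def StarCond (n k : ℕ) (p : Fin k → ℕ) : Prop :=
  ∀ j : Fin k,
    ((j : ℕ) + 1) * magicConst n k ≤ ∑ i ∈ Finset.range (∑ t ∈ Finset.Iic j, p t), (n - i)

/-- The width `ω(A)` of a partition: the minimum of `y − x` over pairs `x < y` with `x`
in a low set and `y` in a high set (`⊤` if there is no such pair). -/
noncomputable def width (n : ℕ) {k : ℕ} (A : Fin k → Finset ℕ) : ℕ∞ :=
  sInf { w : ℕ∞ | ∃ (x y : ℕ) (i j : Fin k), x ∈ A i ∧ y ∈ A j ∧ x < y ∧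
    (A i).sum id < magicConst n k ∧ magicConst n k < (A j).sum id ∧ w = (y - x : ℕ) }

/-- A `k`-element subset of `[n]` has sum at most that of the `k` largest elements. -/
theorem sum_le_sum_range_sub (n : ℕ) (A : Finset ℕ) (hA : A ⊆ Icc 1 n) :
    A.sum id ≤ ∑ i ∈ range A.card, (n - i) := by
  induction n generalizing A with
  | zero =>
    have : A = ∅ := by simpa using hA
    simp [this]
  | succ n ih =>
    by_cases h : n + 1 ∈ A
    · have hsub : A.erase (n + 1) ⊆ Icc 1 n := by
        intro x hx
        have h1 := mem_erase.1 hx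
        have h2 := mem_Icc.1 (hA h1.2)
        exact mem_Icc.2 ⟨h2.1, by omega⟩
      have h3 := ih _ hsub
      have h4 := add_sum_erase A id h
      rw [← card_erase_add_one h, sum_range_succ']
      simp only [Nat.add_sub_add_right, Nat.sub_zero, id] at *
      omega
    · have hsub : A ⊆ Icc 1 n := by
        intro x hx
        have h2 := mem_Icc.1 (hA hx)
        have h3 : x ≠ n + 1 := fun h' => h (h' ▸ hx)
        exact mem_Icc.2 ⟨h2.1, by omega⟩
      exact (ih _ hsub).trans (sum_le_sum fun i _ => by omega)

/-- Every value between the minimal and maximal sum of a `k`-element subset of `[n]` is the sum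
of such a subset. -/
theorem exists_subset_Icc_card_eq_sum_eq (n k s : ℕ) (hk : k ≤ n)
    (hmin : ∑ i ∈ range k, (i + 1) ≤ s) (hmax : s ≤ ∑ i ∈ range k, (n - i)) :
    ∃ A ⊆ Icc 1 n, A.card = k ∧ A.sum id = s := by
  induction n generalizing k s with
  | zero =>
    obtain rfl : k = 0 := by omega
    exact ⟨∅, by simp, by simp, by simpa [eq_comm] using hmax⟩
  | succ n ih =>
    rcases k with _ | k
    · exact ⟨∅, by simp, by simp, by simpa [eq_comm] using hmax⟩
    by_cases h : n + 1 + ∑ i ∈ range k, (i + 1) ≤ s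
    · rw [sum_range_succ'] at hmax
      simp only [Nat.add_sub_add_right, Nat.sub_zero] at hmax
      obtain ⟨A, hA, hc, hs⟩ := ih k (s - (n + 1)) (by omega) (by omega) (by omega)
      have hn : n + 1 ∉ A := fun h' => by have := mem_Icc.1 (hA h'); omega
      refine ⟨insert (n + 1) A, ?_, by rw [card_insert_of_notMem hn, hc], ?_⟩
      · exact insert_subset (by simp) (hA.trans (Icc_subset_Icc_right (by omega)))
      · rw [sum_insert hn, hs, id]
        omega
    · have hkn : k + 1 ≤ n := by
        rw [sum_range_succ] at hmin
        omega
      obtain ⟨A, hA, hc, hs⟩ := ih (k + 1) s hkn hmin (by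
        have h1 : ∑ i ∈ range k, (i + 1) ≤ ∑ i ∈ range k, (n - (i + 1)) := by
          rw [← sum_range_reflect]
          exact sum_le_sum fun i hi => by have := mem_range.1 hi; omega
        rw [sum_range_succ']
        omega)
      exact ⟨A, hA.trans (Icc_subset_Icc_right (by omega)), hc, hs⟩

/-- Conjecture 1 holds for `k = 2`. -/
theorem stmt_2 (n : ℕ) (hn : 0 < n) (hdvd : 2 ∣ n * (n + 1) / 2)
    (p : Fin 2 → ℕ) (hp1 : 1 < p 0) (hmono : Monotone p)
    (hsum : ∑ i : Fin 2, p i = n) :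
    (∃ A : Fin 2 → Finset ℕ, Implements n A p ∧ Equitable n A) ↔
      magicConst n 2 ≤ ∑ i ∈ Finset.range (p 0), (n - i) := by
  constructor
  · rintro ⟨A, ⟨⟨-, hU⟩, e, he⟩, hE⟩
    rw [← hE (e 0), ← he 0]
    exact sum_le_sum_range_sub n _ (hU ▸ subset_biUnion_of_mem A (mem_univ _))
  · intro h
    have h01 : p 0 ≤ p 1 := hmono (by decide)
    rw [Fin.sum_univ_two] at hsum
    have hgauss (m : ℕ) : (∑ i ∈ range m, (i + 1)) * 2 = m * (m + 1) := by
      have := sum_range_id_mul_two (m + 1)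
      rw [sum_range_succ'] at this
      simpa [mul_comm] using this
    have hG : (∑ i ∈ range n, (i + 1)) = 2 * magicConst n 2 := by
      have := hgauss n
      unfold magicConst
      omega
    have hmin : ∑ i ∈ range (p 0), (i + 1) ≤ magicConst n 2 := by
      have h1 := hgauss (p 0)
      have h2 := hgauss n
      have h3 : 2 * (p 0 * (p 0 + 1)) ≤ n * (n + 1) := by
        rw [← mul_assoc]
        exact Nat.mul_le_mul (by omega) (by omega)
      omega
    obtain ⟨A, hA, hc, hs⟩ :=
      exists_subset_Icc_card_eq_sum_eq n (p 0) (magicConst n 2) (by omega) hmin h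
    refine ⟨![A, Icc 1 n \ A], ⟨⟨?_, ?_⟩, Equiv.refl _, ?_⟩, ?_⟩
    · intro i j hij
      fin_cases i <;> fin_cases j <;> simp_all [disjoint_sdiff, sdiff_disjoint]
    · ext x
      have := @hA x
      simp only [mem_biUnion, mem_univ, true_and, Fin.exists_fin_two, Matrix.cons_val_zero,
        Matrix.cons_val_one, mem_sdiff]
      tauto
    · have := card_sdiff_of_subset hA
      rw [Nat.card_Icc] at this
      rw [Fin.forall_fin_two]
      exact ⟨hc, this.trans (by omega)⟩
    · have h1 : (Icc 1 n \ A).sum id + A.sum id = (Icc 1 n).sum id := sum_sdiff hA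
      have h2 : (Icc 1 n).sum id = ∑ i ∈ range n, (i + 1) := by
        rw [range_eq_Ico, sum_Ico_add' (fun i => i) 0 n 1]
        rfl
      refine Fin.forall_fin_two.2 ⟨hs, ?_⟩
      change (Icc 1 n \ A).sum id = _
      omega
end

section
/- Let n be a positive integer with 3 dividing n(n+1)/2, and let 1 < p_1 ≤ p_2 ≤ p_3 be integers with p_1+p_2+p_3 = n. Then there exists an equitable partition of [n] implementing (p_1,p_2,p_3) if and only if Σ_{i=1}^{P_j} (n−i+1) ≥ j·s^{n,3} for all j = 1,2,3, where P_j = p_1+…+p_j. -/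
open Finset

/-- The numerical conditions on sizes `a, b, c` and sums `x, y, z` that are necessary for
partitioning `[a + b + c]` into three sets with these sizes and sums. -/
structure Feasible (a b c x y z : ℕ) : Prop where
  fst : a * (a + 1) ≤ 2 * x
  snd : b * (b + 1) ≤ 2 * y
  thd : c * (c + 1) ≤ 2 * z
  fst_snd : (a + b) * (a + b + 1) ≤ 2 * (x + y)
  fst_thd : (a + c) * (a + c + 1) ≤ 2 * (x + z)
  snd_thd : (b + c) * (b + c + 1) ≤ 2 * (y + z)
  total : 2 * (x + y + z) = (a + b + c) * (a + b + c + 1)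

/-- `[a + b + c]` splits into three sets of sizes `a, b, c` and sums `x, y, z`. -/
def Realizable (a b c x y z : ℕ) : Prop :=
  ∃ A B C : Finset ℕ, Disjoint A B ∧ Disjoint A C ∧ Disjoint B C ∧
    A ∪ B ∪ C = Icc 1 (a + b + c) ∧ #A = a ∧ #B = b ∧ #C = c ∧
    A.sum id = x ∧ B.sum id = y ∧ C.sum id = z

theorem Feasible.swap {a b c x y z : ℕ} (h : Feasible a b c x y z) :
    Feasible b a c y x z := by
  obtain ⟨h1, h2, h3, h4, h5, h6, h7⟩ := h
  refine ⟨h2, h1, h3, ?_, h6, h5, ?_⟩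
  · rwa [add_comm b a, add_comm y x]
  · rwa [add_comm b a, add_comm y x]

theorem Feasible.rotate {a b c x y z : ℕ} (h : Feasible a b c x y z) :
    Feasible c a b z x y := by
  obtain ⟨h1, h2, h3, h4, h5, h6, h7⟩ := h
  refine ⟨h3, h1, h2, ?_, ?_, h4, ?_⟩
  · rwa [add_comm c a, add_comm z x]
  · rwa [add_comm c b, add_comm z y]
  · rwa [add_assoc c a b, add_comm c, add_assoc z x y, add_comm z]

theorem Realizable.swap {a b c x y z : ℕ} (h : Realizable a b c x y z) :
    Realizable b a c y x z := by
  obtain ⟨A, B, C, hAB, hAC, hBC, hU, ha, hb, hc, hx, hy, hz⟩ := h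
  exact ⟨B, A, C, hAB.symm, hBC, hAC, by rw [union_comm B A, hU, add_comm a b],
    hb, ha, hc, hy, hx, hz⟩

theorem Realizable.rotate {a b c x y z : ℕ} (h : Realizable a b c x y z) :
    Realizable b c a y z x := by
  obtain ⟨A, B, C, hAB, hAC, hBC, hU, ha, hb, hc, hx, hy, hz⟩ := h
  refine ⟨B, C, A, hBC, hAB.symm, hAC.symm, ?_, hb, hc, ha, hy, hz, hx⟩
  rw [union_comm (B ∪ C) A, ← union_assoc, hU, add_comm (b + c) a, add_assoc]

theorem two_mul_sum_Icc (n : ℕ) : 2 * (Icc 1 n).sum id = n * (n + 1) := by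
  induction n with
  | zero => simp
  | succ n ih =>
    rw [sum_Icc_succ_top (by omega), mul_add, ih]
    simp only [id]
    ring

/-- Two disjoint sets of the right sizes and sums determine the third. -/
theorem realizable_of_disjoint {a b c x y z : ℕ} {A B : Finset ℕ}
    (hA : A ⊆ Icc 1 (a + b + c)) (hB : B ⊆ Icc 1 (a + b + c)) (hAB : Disjoint A B)
    (ha : #A = a) (hb : #B = b) (hx : A.sum id = x) (hy : B.sum id = y)
    (total : 2 * (x + y + z) = (a + b + c) * (a + b + c + 1)) :
    Realizable a b c x y z := by
  have hsub : A ∪ B ⊆ Icc 1 (a + b + c) := union_subset hA hB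
  refine ⟨A, B, Icc 1 (a + b + c) \ (A ∪ B), hAB,
    disjoint_sdiff.mono_left subset_union_left, disjoint_sdiff.mono_left subset_union_right,
    union_sdiff_of_subset hsub, ha, hb, ?_, hx, hy, ?_⟩
  · rw [card_sdiff_of_subset hsub, card_union_of_disjoint hAB, Nat.card_Icc]
    omega
  · have h1 := sum_sdiff (f := id) hsub
    rw [sum_union hAB] at h1
    have h2 := two_mul_sum_Icc (a + b + c)
    linarith

/-- Adding the new largest element to the first part. -/
theorem Realizable.insert_max {a b c x y z : ℕ} (h : Realizable a b c x y z) :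
    Realizable (a + 1) b c (x + (a + b + c + 1)) y z := by
  obtain ⟨A, B, C, hAB, hAC, hBC, hU, ha, hb, hc, hx, hy, hz⟩ := h
  have hout : a + b + c + 1 ∉ A ∪ B ∪ C := by rw [hU]; simp
  simp only [mem_union, not_or] at hout
  obtain ⟨⟨hnA, hnB⟩, hnC⟩ := hout
  refine ⟨insert (a + b + c + 1) A, B, C, disjoint_insert_left.2 ⟨hnB, hAB⟩,
    disjoint_insert_left.2 ⟨hnC, hAC⟩, hBC, ?_, by rw [card_insert_of_notMem hnA, ha],
    hb, hc, ?_, hy, hz⟩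
  · rw [insert_union, insert_union, hU]
    ext i
    simp only [mem_insert, mem_Icc]
    omega
  · rw [sum_insert hnA, hx, id, add_comm]

/-- Subsets of `[b + c]` of size `b` attain every sum between the extreme ones. -/
theorem exists_subset_sum_eq (b c d : ℕ) (h : d ≤ b * c) :
    ∃ B ⊆ Icc 1 (b + c), #B = b ∧ 2 * B.sum id = b * (b + 1) + 2 * d := by
  induction b generalizing c d with
  | zero => exact ⟨∅, by simp, by simp, by simp at h; simp [h]⟩
  | succ b ih =>
    obtain hd | hd := le_total d c
    · obtain ⟨B, hB, hcard, hsum⟩ := ih 0 0 (by simp)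
      have hn : b + 1 + d ∉ B := fun hmem => by have := mem_Icc.1 (hB hmem); omega
      refine ⟨insert (b + 1 + d) B, ?_, by rw [card_insert_of_notMem hn, hcard], ?_⟩
      · refine insert_subset (by simp only [mem_Icc]; omega) (hB.trans ?_)
        exact Icc_subset_Icc le_rfl (by omega)
      · rw [sum_insert hn, id, mul_add, hsum]
        ring
    · obtain ⟨e, rfl⟩ := Nat.exists_eq_add_of_le hd
      obtain ⟨B, hB, hcard, hsum⟩ := ih c e (by rw [add_mul] at h; omega)
      have hn : b + 1 + c ∉ B := fun hmem => by have := mem_Icc.1 (hB hmem); omega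
      refine ⟨insert (b + 1 + c) B, ?_, by rw [card_insert_of_notMem hn, hcard], ?_⟩
      · refine insert_subset (by simp only [mem_Icc]; omega) (hB.trans ?_)
        exact Icc_subset_Icc le_rfl (by omega)
      · rw [sum_insert hn, id, mul_add, hsum]
        ring

/-- Attainable sums of sets with `q` elements below `q + w + 1` and `t` elements above it. -/
theorem exists_subset_sum_eq_of_blocks (q w t u d : ℕ) (h : d ≤ q * w + t * u) :
    ∃ B ⊆ Icc 1 (q + w + 1 + (t + u)), q + w + 1 ∉ B ∧ #B = q + t ∧
      2 * B.sum id = q * (q + 1) + t * (t + 1) + 2 * t * (q + w + 1) + 2 * d := by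
  obtain ⟨d₁, d₂, rfl, h₁, h₂⟩ : ∃ d₁ d₂, d = d₁ + d₂ ∧ d₁ ≤ q * w ∧ d₂ ≤ t * u :=
    ⟨min d (q * w), d - min d (q * w), by omega, by omega, by omega⟩
  obtain ⟨L, hL, hLcard, hLsum⟩ := exists_subset_sum_eq q w d₁ h₁
  obtain ⟨H, hH, hHcard, hHsum⟩ := exists_subset_sum_eq t u d₂ h₂
  have hmem : ∀ i ∈ H.map (addRightEmbedding (q + w + 1)),
      q + w + 1 < i ∧ i ≤ q + w + 1 + (t + u) := by
    intro i hi
    obtain ⟨j, hj, rfl⟩ := mem_map.1 hi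
    have := mem_Icc.1 (hH hj)
    simp only [addRightEmbedding_apply]
    omega
  have hdisj : Disjoint L (H.map (addRightEmbedding (q + w + 1))) := by
    rw [disjoint_left]
    intro i hi hi'
    have := mem_Icc.1 (hL hi)
    have := hmem i hi'
    omega
  refine ⟨L ∪ H.map (addRightEmbedding (q + w + 1)), union_subset ?_ ?_, ?_, ?_, ?_⟩
  · exact hL.trans (Icc_subset_Icc le_rfl (by omega))
  · intro i hi
    have := hmem i hi
    simp only [mem_Icc]
    omega
  · intro hi
    obtain hi | hi := mem_union.1 hi
    · have := mem_Icc.1 (hL hi)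
      omega
    · have := hmem _ hi
      omega
  · rw [card_union_of_disjoint hdisj, card_map, hLcard, hHcard]
  · rw [sum_union hdisj, sum_map, mul_add, hLsum]
    simp only [addRightEmbedding_apply, id, sum_add_distrib, sum_const, smul_eq_mul, hHcard]
    have : 2 * ∑ i ∈ H, i = t * (t + 1) + 2 * d₂ := hHsum
    linarith

/-- Starting from a split of a size `b = q + t` whose least sum is at most `y`, a set of sum `y`
avoiding `q + w + 1` exists, outside two exceptional cases. -/
theorem exists_subset_sum_eq_avoiding {q w t u b c y z : ℕ} (hb : 2 ≤ b) (hc : 2 ≤ c)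
    (hbq : q + t = b) (hcw : w + u = c)
    (hy : q * (q + 1) + t * (t + 1) + 2 * t * (q + w + 1) ≤ 2 * y)
    (hz : c * (c + 1) ≤ 2 * z) (hvz : (1 + c) * (1 + c + 1) ≤ 2 * (q + w + 1 + z))
    (total : 2 * (q + w + 1 + y + z) = (1 + b + c) * (1 + b + c + 1))
    (hexb : q + w + 1 = b + 1 → 2 * y ≠ b * (b + 1) + 2)
    (hexc : q + w + 1 = c + 1 → 2 * z ≠ c * (c + 1) + 2) :
    ∃ B ⊆ Icc 1 (1 + b + c), q + w + 1 ∉ B ∧ #B = b ∧ B.sum id = y := by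
  obtain ⟨m, hm⟩ : Even (q * (q + 1) + t * (t + 1) + 2 * t * (q + w + 1)) :=
    ((Nat.even_mul_succ_self q).add (Nat.even_mul_succ_self t)).add
      ⟨t * (q + w + 1), by ring⟩
  by_cases hM :
      2 * y ≤ q * (q + 1) + t * (t + 1) + 2 * t * (q + w + 1) + 2 * (q * w + t * u)
  · obtain ⟨B, hB, hv, hcard, hsum⟩ :=
      exists_subset_sum_eq_of_blocks q w t u (y - m) (by omega)
    refine ⟨B, ?_, hv, by omega, by omega⟩
    rwa [show 1 + b + c = q + w + 1 + (t + u) by omega]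
  · rw [not_le] at hM
    subst hbq hcw
    cases q with
    | zero => nlinarith
    | succ q =>
      cases u with
      | zero => nlinarith
      | succ u =>
        have hy' : q * (q + 1) + (t + 1) * (t + 1 + 1) + 2 * (t + 1) * (q + (w + 1) + 1)
            ≤ 2 * y := by
          have hM' : m + ((q + 1) * w + t * (u + 1)) + 1 ≤ y := by omega
          by_cases hgap : 1 ≤ t * u + w * q
          · nlinarith
          have htu : t * u = 0 := by omega
          have hwq : w * q = 0 := by omega
          by_contra hlt
          have hyM : y = m + ((q + 1) * w + t * (u + 1)) + 1 := by nlinarith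
          obtain rfl | rfl := mul_eq_zero.1 htu <;> obtain rfl | rfl := mul_eq_zero.1 hwq
          · exact hexb (by ring) (by linarith)
          · omega
          · omega
          · exact hexc (by ring) (by linarith)
        obtain ⟨B, hB, hv, hcard, hsum⟩ :=
          exists_subset_sum_eq_avoiding (q := q) (w := w + 1) (t := t + 1) (u := u)
            (y := y) (z := z) hb hc (by ring) (by ring)
            hy' hz (by convert hvz using 3; ring) (by convert total using 3; ring)
            (fun h => hexb (by omega)) (fun h => hexc (by omega))
        exact ⟨B, hB, by rwa [show q + 1 + w + 1 = q + (w + 1) + 1 by ring], hcard, hsum⟩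
termination_by q

theorem Feasible.realizable_of_one {b c v y z : ℕ} (h : Feasible 1 b c v y z)
    (hb : 2 ≤ b) (hc : 2 ≤ c)
    (hexb : v = b + 1 → 2 * y ≠ b * (b + 1) + 2)
    (hexc : v = c + 1 → 2 * z ≠ c * (c + 1) + 2) : Realizable 1 b c v y z := by
  obtain ⟨h1, h2, h3, h4, h5, h6, h7⟩ := h
  have hvn : v ≤ 1 + b + c := by nlinarith
  suffices ∃ B ⊆ Icc 1 (1 + b + c), v ∉ B ∧ #B = b ∧ B.sum id = y by
    obtain ⟨B, hB, hv, hcard, hsum⟩ := this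
    refine realizable_of_disjoint (A := {v}) ?_ hB ?_ (by simp) hcard (by simp) hsum h7
    · simp only [singleton_subset_iff, mem_Icc]
      omega
    · simpa using hv
  obtain hbv | hbv := lt_or_ge b v
  · obtain ⟨w, rfl⟩ := Nat.exists_eq_add_of_lt hbv
    obtain ⟨u, rfl⟩ := Nat.exists_eq_add_of_le (show w ≤ c by omega)
    exact exists_subset_sum_eq_avoiding (t := 0) hb hc (by ring) rfl (by linarith) h3 h5 h7
      hexb hexc
  · obtain ⟨q, rfl⟩ := Nat.exists_eq_add_of_le' (show 1 ≤ v by omega)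
    obtain ⟨t, rfl⟩ := Nat.exists_eq_add_of_le (show q ≤ b by omega)
    exact exists_subset_sum_eq_avoiding (w := 0) (u := c) hb hc rfl (by ring) (by nlinarith)
      h3 h5 h7 hexb hexc

theorem realizable_two_of_exceptional {b c y z : ℕ} (hb : 2 ≤ b) (hc : 2 ≤ c)
    (hy : 2 * y = b * (b + 1) + 2)
    (total : 2 * (2 + b + c + (b + 1) + y + z) = (2 + b + c) * (2 + b + c + 1)) :
    Realizable 2 b c (2 + b + c + (b + 1)) y z := by
  obtain ⟨m, rfl⟩ := Nat.exists_eq_add_of_le' (show 1 ≤ b by omega)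
  have hB := two_mul_sum_Icc m
  have hn : m + 2 ∉ Icc 1 m := by simp
  refine realizable_of_disjoint (A := {m + 3, m + c + 2}) (B := insert (m + 2) (Icc 1 m))
    ?_ ?_ ?_ (card_pair (by omega)) ?_ ?_ ?_ total
  · intro i hi
    simp only [mem_insert, mem_singleton] at hi
    simp only [mem_Icc]
    omega
  · intro i hi
    simp only [mem_insert, mem_Icc] at hi ⊢
    omega
  · rw [disjoint_left]
    intro i hi hi'
    simp only [mem_insert, mem_singleton, mem_Icc] at hi hi'
    omega
  · simp [card_insert_of_notMem hn]
  · rw [sum_pair (by omega)]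
    simp only [id]
    ring
  · rw [sum_insert hn, id]
    nlinarith

/-- The inductive step: placing the largest element in the first part. -/
theorem Feasible.realizable_of_slack {n a b c x y z : ℕ}
    (ih : ∀ a b c x y z, a + b + c = n → 2 ≤ a → 2 ≤ b → 2 ≤ c → Feasible a b c x y z →
      Realizable a b c x y z)
    (hn : a + b + c = n + 1) (ha : 2 ≤ a) (hb : 2 ≤ b) (hc : 2 ≤ c)
    (h : Feasible a b c x y z) (hx : a * (a + 1) + 2 * (b + c) ≤ 2 * x)
    (hxy : (a + b) * (a + b + 1) + 2 * c ≤ 2 * (x + y))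
    (hxz : (a + c) * (a + c + 1) + 2 * b ≤ 2 * (x + z)) : Realizable a b c x y z := by
  obtain ⟨h1, h2, h3, h4, h5, h6, h7⟩ := h
  obtain ⟨k, rfl⟩ := Nat.exists_eq_add_of_le' (show 1 ≤ a by omega)
  obtain ⟨v, rfl⟩ := Nat.exists_eq_add_of_le' (show k + b + c + 1 ≤ x by nlinarith)
  have hf : Feasible k b c v y z :=
    ⟨by nlinarith, h2, h3, by nlinarith, by nlinarith, h6, by nlinarith⟩
  obtain hk | rfl : 2 ≤ k ∨ k = 1 := by omega
  · exact (ih k b c v y z (by omega) hk hb hc hf).insert_max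
  · by_cases hexb : v = b + 1 ∧ 2 * y = b * (b + 1) + 2
    · obtain ⟨rfl, hy⟩ := hexb
      rw [show b + 1 + (1 + b + c + 1) = 2 + b + c + (b + 1) by ring] at h7 ⊢
      exact realizable_two_of_exceptional hb hc hy h7
    by_cases hexc : v = c + 1 ∧ 2 * z = c * (c + 1) + 2
    · obtain ⟨rfl, hz⟩ := hexc
      have : Realizable 2 c b (2 + c + b + (c + 1)) z y :=
        realizable_two_of_exceptional hc hb hz (by linarith)
      rw [show c + 1 + (1 + b + c + 1) = 2 + c + b + (c + 1) by ring]
      exact this.rotate.swap.rotate.rotate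
    exact (hf.realizable_of_one hb hc (fun h h' => hexb ⟨h, h'⟩)
      (fun h h' => hexc ⟨h, h'⟩)).insert_max

/-- For parts of size at least two, the necessary conditions are sufficient. -/
theorem Feasible.realizable {a b c x y z : ℕ} (h : Feasible a b c x y z)
    (ha : 2 ≤ a) (hb : 2 ≤ b) (hc : 2 ≤ c) : Realizable a b c x y z := by
  obtain ⟨n, hn⟩ : ∃ n, a + b + c = n := ⟨_, rfl⟩
  induction n generalizing a b c x y z with
  | zero => omega
  | succ n ih =>
    replace ih : ∀ a b c x y z, a + b + c = n → 2 ≤ a → 2 ≤ b → 2 ≤ c →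
        Feasible a b c x y z → Realizable a b c x y z :=
      fun a b c x y z hn ha hb hc h => ih h ha hb hc hn
    have fstPart := fun hx hxy hxz => h.realizable_of_slack ih hn ha hb hc hx hxy hxz
    have sndPart := fun hy hyx hyz =>
      (h.swap.realizable_of_slack ih (by omega) hb ha hc hy hyx hyz).swap
    have thdPart := fun hz hzx hzy =>
      (h.rotate.realizable_of_slack ih (by omega) hc ha hb hz hzx hzy).rotate
    obtain ⟨h1, h2, h3, h4, h5, h6, h7⟩ := h
    have hab : 0 ≤ (a - 2 : ℤ) * (b - 2) := mul_nonneg (by omega) (by omega)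
    have hac : 0 ≤ (a - 2 : ℤ) * (c - 2) := mul_nonneg (by omega) (by omega)
    have hbc : 0 ≤ (b - 2 : ℤ) * (c - 2) := mul_nonneg (by omega) (by omega)
    zify at *
    by_cases hyz : ((b + c) * (b + c + 1) + 2 * a : ℤ) ≤ 2 * (y + z)
    · by_cases hxz : ((a + c) * (a + c + 1) + 2 * b : ℤ) ≤ 2 * (x + z)
      · by_cases hxy : ((a + b) * (a + b + 1) + 2 * c : ℤ) ≤ 2 * (x + y)
        · by_cases hx : (a * (a + 1) + 2 * (b + c) : ℤ) ≤ 2 * x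
          · exact fstPart hx hxy hxz
          by_cases hy : (b * (b + 1) + 2 * (a + c) : ℤ) ≤ 2 * y
          · exact sndPart hy (by linarith) hyz
          exact thdPart (by nlinarith) (by linarith) (by linarith)
        · exact thdPart (by nlinarith) (by linarith) (by linarith)
      · exact sndPart (by nlinarith) (by nlinarith) (by linarith)
    · exact fstPart (by nlinarith) (by nlinarith) (by nlinarith)

theorem card_mul_succ_le_two_mul_sum (U : Finset ℕ) (hU : ∀ i ∈ U, 0 < i) :
    #U * (#U + 1) ≤ 2 * U.sum id := by
  induction U using Finset.induction_on_max with
  | empty => simp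
  | insert m U hm ih =>
    have hn : m ∉ U := fun h => lt_irrefl _ (hm m h)
    have hlt : #U + 1 ≤ m := by
      have hsub : U ⊆ Ico 1 m := fun i hi =>
        mem_Ico.2 ⟨hU i (mem_insert_of_mem hi), hm i hi⟩
      have := card_le_card hsub
      have := hU m (mem_insert_self _ _)
      rw [Nat.card_Ico] at *
      omega
    have := ih fun i hi => hU i (mem_insert_of_mem hi)
    rw [card_insert_of_notMem hn, sum_insert hn, id]
    nlinarith

theorem two_mul_sum_range_sub (m l : ℕ) :
    2 * ∑ i ∈ range m, (m + l - i) + l * (l + 1) = (m + l) * (m + l + 1) := by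
  induction m generalizing l with
  | zero => simp
  | succ m ih =>
    have := ih (l + 1)
    rw [sum_range_succ, show m + 1 + l - m = l + 1 by omega]
    rw [show m + (l + 1) = m + 1 + l by ring] at this
    nlinarith

theorem six_mul_magicConst {n : ℕ} (hdvd : 3 ∣ n * (n + 1) / 2) :
    6 * magicConst n 3 = n * (n + 1) := by
  have h1 := Nat.mul_div_cancel' hdvd
  have h2 := Nat.mul_div_cancel' (Nat.even_mul_succ_self n).two_dvd
  unfold magicConst
  omega

/-- The condition `StarCond` for `k = 3`, phrased through the smallest elements of `[n]`. -/
theorem starCond_three_iff {n : ℕ} (hdvd : 3 ∣ n * (n + 1) / 2) {p : Fin 3 → ℕ}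
    (hsum : p 0 + p 1 + p 2 = n) :
    StarCond n 3 p ↔ (p 1 + p 2) * (p 1 + p 2 + 1) ≤ 4 * magicConst n 3 ∧
      p 2 * (p 2 + 1) ≤ 2 * magicConst n 3 := by
  have h6 := six_mul_magicConst hdvd
  have e0 := two_mul_sum_range_sub (p 0) (p 1 + p 2)
  have e1 := two_mul_sum_range_sub (p 0 + p 1) (p 2)
  have e2 := two_mul_sum_range_sub n 0
  rw [← add_assoc, hsum] at e0
  rw [hsum] at e1
  have i0 : (Iic (0 : Fin 3)) = {0} := by decide
  have i1 : (Iic (1 : Fin 3)) = {0, 1} := by decide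
  have i2 : (Iic (2 : Fin 3)) = {0, 1, 2} := by decide
  have hstar : StarCond n 3 p ↔
      magicConst n 3 ≤ ∑ i ∈ range (p 0), (n - i) ∧
      2 * magicConst n 3 ≤ ∑ i ∈ range (p 0 + p 1), (n - i) ∧
      3 * magicConst n 3 ≤ ∑ i ∈ range n, (n - i) := by
    simp [StarCond, Fin.forall_fin_succ, i0, i1, i2, ← hsum, add_assoc]
  rw [hstar]
  constructor
  · rintro ⟨h0, h1, -⟩
    constructor <;> linarith
  · rintro ⟨h0, h1⟩
    refine ⟨by linarith, by linarith, by simp at e2; linarith⟩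

/-- Conjecture 1 holds for `k = 3`. -/
theorem stmt_3 (n : ℕ) (hn : 0 < n) (hdvd : 3 ∣ n * (n + 1) / 2)
    (p : Fin 3 → ℕ) (hp1 : 1 < p 0) (hmono : Monotone p)
    (hsum : ∑ i : Fin 3, p i = n) :
    (∃ A : Fin 3 → Finset ℕ, Implements n A p ∧ Equitable n A) ↔ StarCond n 3 p := by
  have hsum' : p 0 + p 1 + p 2 = n := by simpa [Fin.sum_univ_three] using hsum
  have h6 := six_mul_magicConst hdvd
  rw [starCond_three_iff hdvd hsum']
  constructor
  · rintro ⟨A, ⟨⟨hdisj, hU⟩, e, he⟩, heq⟩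
    have hpos : ∀ j, ∀ i ∈ A j, 0 < i := fun j i hi => by
      have : i ∈ Icc 1 n := hU ▸ mem_biUnion.2 ⟨j, mem_univ _, hi⟩
      exact (mem_Icc.1 this).1
    have h12 : Disjoint (A (e 1)) (A (e 2)) := hdisj _ _ (e.injective.ne (by decide))
    have l12 := card_mul_succ_le_two_mul_sum (A (e 1) ∪ A (e 2)) fun i hi =>
      (mem_union.1 hi).elim (hpos _ i) (hpos _ i)
    have l2 := card_mul_succ_le_two_mul_sum (A (e 2)) (hpos _)
    rw [card_union_of_disjoint h12, sum_union h12, he, he, heq, heq] at l12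
    rw [he, heq] at l2
    exact ⟨by linarith, l2⟩
  · rintro ⟨h12, h2⟩
    have m01 : p 0 ≤ p 1 := hmono (by decide)
    have m12 : p 1 ≤ p 2 := hmono (by decide)
    have hf : Feasible (p 0) (p 1) (p 2) (magicConst n 3) (magicConst n 3)
        (magicConst n 3) := by
      refine ⟨?_, ?_, h2, ?_, ?_, ?_, ?_⟩
      · nlinarith
      · nlinarith
      · nlinarith
      · nlinarith
      · linarith
      · rw [hsum']
        linarith
    obtain ⟨X, Y, Z, hXY, hXZ, hYZ, hU, hX, hY, hZ, sX, sY, sZ⟩ :=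
      hf.realizable (by omega) (by omega) (by omega)
    refine ⟨![X, Y, Z], ⟨⟨?_, ?_⟩, Equiv.refl _, ?_⟩, ?_⟩
    · intro i j hij
      fin_cases i <;> fin_cases j <;>
        first
        | exact absurd rfl hij
        | assumption
        | (apply Disjoint.symm; assumption)
    · rw [← hsum', ← hU]
      ext i
      simp [Fin.exists_fin_succ]
    · intro i
      fin_cases i <;> assumption
    · intro i
      fin_cases i <;> assumption
end

section
/- Let n and k be positive integers with k dividing n(n+1)/2, and let p_1 ≤ … ≤ p_k be positive integers with p_1+…+p_k = n satisfying condition (★). Suppose there is no equitable partition of [n] implementing (p_1,…,p_k), and let A be a minimal partition implementing (p_1,…,p_k). Then there exists t ∈ [n] lying in a low set of A with t+1 lying in an exact set of A, and there exists s ∈ [n] lying in an exact set of A with s+1 lying in a high set of A. -/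
open Finset

/-- Exchanging `t` and `t + 1` changes the sum of a set by at most one. -/
theorem sum_map_swap_succ (s : Finset ℕ) (t : ℕ) :
    (((s.map (Equiv.swap t (t + 1)).toEmbedding).sum id : ℕ) : ℤ) =
      (s.sum id : ℕ) + (if t ∈ s then 1 else 0) - (if t + 1 ∈ s then 1 else 0) := by
  have h : ∀ x : ℕ, ((Equiv.swap t (t + 1) x : ℕ) : ℤ) =
      x + (if t = x then 1 else 0) - (if t + 1 = x then 1 else 0) := by
    intro x
    rw [Equiv.swap_apply_def]
    split_ifs <;> omega
  simp only [Finset.sum_map, id, Nat.cast_sum, Equiv.coe_toEmbedding, h,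
    Finset.sum_sub_distrib, Finset.sum_add_distrib, Finset.sum_ite_eq]

/-- Exchanging two elements of `[n]` preserves the implemented size sequence. -/
theorem Implements.map_swap {n k : ℕ} {A : Fin k → Finset ℕ} {p : Fin k → ℕ}
    (hA : Implements n A p) {a b : ℕ} (ha : a ∈ Finset.Icc 1 n) (hb : b ∈ Finset.Icc 1 n) :
    Implements n (fun l => (A l).map (Equiv.swap a b).toEmbedding) p := by
  obtain ⟨⟨hdisj, hU⟩, e, he⟩ := hA
  refine ⟨⟨fun i j hij => (Finset.disjoint_map _).2 (hdisj i j hij), ?_⟩, e, fun i => ?_⟩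
  · have hmaps : ∀ y ∈ Finset.Icc 1 n, Equiv.swap a b y ∈ Finset.Icc 1 n := by
      intro y hy
      rw [Equiv.swap_apply_def]
      split_ifs <;> assumption
    ext x
    have hx : x ∈ Finset.univ.biUnion (fun l => (A l).map (Equiv.swap a b).toEmbedding) ↔
        Equiv.swap a b x ∈ Finset.univ.biUnion A := by
      simp [Finset.mem_map_equiv]
    rw [hx, hU]
    exact ⟨fun h => by simpa using hmaps _ h, hmaps x⟩
  · simpa using he i

/-- In a minimal partition the successor of an element of a low set is in no high set. -/
theorem MinimalPartition.not_low_high {n k : ℕ} {A : Fin k → Finset ℕ} {p : Fin k → ℕ}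
    (hA : MinimalPartition n A p) {t : ℕ} {i j : Fin k} (ht : t ∈ A i) (ht' : t + 1 ∈ A j)
    (hi : (A i).sum id < magicConst n k) (hj : magicConst n k < (A j).sum id) : False := by
  have hij : i ≠ j := by
    rintro rfl
    omega
  have hdisj := hA.1.1.1
  have hmem : ∀ l, ∀ x ∈ A l, x ∈ Finset.Icc 1 n := fun l x hx =>
    hA.1.1.2 ▸ Finset.mem_biUnion.2 ⟨l, Finset.mem_univ l, hx⟩
  have huniq : ∀ {x : ℕ} {l m : Fin k}, x ∈ A m → (x ∈ A l ↔ l = m) := by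
    intro x l m hx
    refine ⟨fun h => ?_, fun h => h ▸ hx⟩
    by_contra hne
    exact Finset.disjoint_left.1 (hdisj l m hne) h hx
  have hmin := hA.2 _ (hA.1.map_swap (hmem i t ht) (hmem j _ ht'))
  have hlt : dVal n (fun l => (A l).map (Equiv.swap t (t + 1)).toEmbedding) < dVal n A := by
    unfold dVal
    have hj' : j ∈ Finset.univ.erase i := Finset.mem_erase.2 ⟨hij.symm, Finset.mem_univ j⟩
    have hrest : ∀ l ∈ (Finset.univ.erase i).erase j,
        (((((A l).map (Equiv.swap t (t + 1)).toEmbedding).sum id : ℕ) : ℤ) - magicConst n k) ^ 2 =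
          (((A l).sum id : ℕ) - (magicConst n k : ℤ)) ^ 2 := by
      intro l hl
      obtain ⟨hlj, hli, -⟩ : l ≠ j ∧ l ≠ i ∧ l ∈ Finset.univ := by
        simpa only [Finset.mem_erase] using hl
      rw [sum_map_swap_succ, if_neg (by rwa [huniq ht]), if_neg (by rwa [huniq ht']),
        add_zero, sub_zero]
    simp only [← Finset.add_sum_erase _ _ (Finset.mem_univ i), ← Finset.add_sum_erase _ _ hj']
    rw [Finset.sum_congr rfl hrest, sum_map_swap_succ, sum_map_swap_succ, if_pos ht,
      if_neg (by rwa [huniq ht']), if_neg (by rw [huniq ht]; exact hij.symm), if_pos ht']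
    have hi' := Int.ofNat_lt.2 hi
    have hj' := Int.ofNat_lt.2 hj
    linarith
  exact absurd hmin (not_le.2 hlt)

/-- A monotone function has its smallest sum over an initial segment. -/
theorem sum_Iic_le_sum_of_card {k : ℕ} {p : Fin k → ℕ} (hmono : Monotone p) (J : Finset (Fin k))
    (m : Fin k) (hJ : J.card = m + 1) : ∑ t ∈ Finset.Iic m, p t ≤ ∑ t ∈ J, p t := by
  have hcard : (Finset.Iic m \ J).card = (J \ Finset.Iic m).card :=
    Finset.card_sdiff_comm (by rw [Fin.card_Iic, hJ])
  have h1 : ∑ t ∈ Finset.Iic m \ J, p t ≤ (Finset.Iic m \ J).card • p m :=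
    Finset.sum_le_card_nsmul _ _ _ fun x hx =>
      hmono (Finset.mem_Iic.1 (Finset.mem_sdiff.1 hx).1)
  have h2 : (J \ Finset.Iic m).card • p m ≤ ∑ t ∈ J \ Finset.Iic m, p t :=
    Finset.card_nsmul_le_sum _ _ _ fun x hx =>
      hmono (le_of_not_ge fun h => (Finset.mem_sdiff.1 hx).2 (Finset.mem_Iic.2 h))
  exact Finset.sum_sdiff_le_sum_sdiff.1 (h1.trans (hcard ▸ h2))

/-- An upward closed subset of `[n]` contains the largest elements of `[n]`. -/
theorem sum_range_le_sum_of_upward_closed {n : ℕ} {U : Finset ℕ} (hU : U ⊆ Finset.Icc 1 n)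
    (hup : ∀ t ∈ U, t < n → t + 1 ∈ U) {P : ℕ} (hP : P ≤ U.card) :
    ∑ i ∈ Finset.range P, (n - i) ≤ U.sum id := by
  have hup' : ∀ x ∈ U, ∀ y, x ≤ y → y ≤ n → y ∈ U := by
    intro x hx y hxy
    induction y, hxy using Nat.le_induction with
    | base => exact fun _ => hx
    | succ y _ ih => exact fun hy => hup y (ih (by omega)) (by omega)
  have hcard : U.card ≤ n := by simpa using Finset.card_le_card hU
  have hmem : ∀ i < U.card, n - i ∈ U := by
    intro i hi
    by_contra hni
    have hsub : U ⊆ Finset.Ioc (n - i) n := by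
      intro x hx
      refine Finset.mem_Ioc.2 ⟨?_, (Finset.mem_Icc.1 (hU hx)).2⟩
      by_contra hle
      exact hni (hup' x hx _ (by omega) (by omega))
    have := Finset.card_le_card hsub
    rw [Nat.card_Ioc] at this
    omega
  calc ∑ i ∈ Finset.range P, (n - i)
      = ((Finset.range P).image (fun i => n - i)).sum id := by
        rw [Finset.sum_image]
        · rfl
        · intro a ha b hb hab
          simp only [Finset.coe_range, Set.mem_Iio] at ha hb hab
          omega
    _ ≤ U.sum id := by
        refine Finset.sum_le_sum_of_subset fun x hx => ?_
        obtain ⟨i, hi, rfl⟩ := Finset.mem_image.1 hx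
        exact hmem i ((Finset.mem_range.1 hi).trans_le hP)

/-- Under `StarCond`, parts whose union is upward closed in `[n]` have average sum at least
`magicConst n k`. -/
theorem StarCond.card_mul_le_sum {n k : ℕ} {A : Fin k → Finset ℕ} {p : Fin k → ℕ}
    (hstar : StarCond n k p) (hmono : Monotone p) (hA : Implements n A p) {I : Finset (Fin k)}
    (hI : I.Nonempty) (hup : ∀ t ∈ I.biUnion A, t < n → t + 1 ∈ I.biUnion A) :
    I.card * magicConst n k ≤ ∑ i ∈ I, (A i).sum id := by
  obtain ⟨⟨hdisj, hU⟩, e, he⟩ := hA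
  have hpair : (I : Set (Fin k)).PairwiseDisjoint A := fun i _ j _ hij => hdisj i j hij
  have hpos := hI.card_pos
  have hle : I.card ≤ k := by simpa using Finset.card_le_univ I
  let m : Fin k := ⟨I.card - 1, by omega⟩
  have hm : (m : ℕ) + 1 = I.card := by
    change I.card - 1 + 1 = I.card
    omega
  have hP : ∑ t ∈ Finset.Iic m, p t ≤ (I.biUnion A).card := by
    refine (sum_Iic_le_sum_of_card hmono (I.map e.symm.toEmbedding) m (by simp [hm])).trans ?_
    rw [Finset.card_biUnion fun i _ j _ hij => hdisj i j hij, Finset.sum_map]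
    refine (Finset.sum_congr rfl fun i _ => ?_).le
    rw [← he]
    simp
  have hsub : I.biUnion A ⊆ Finset.Icc 1 n :=
    hU ▸ Finset.biUnion_subset_biUnion_of_subset_left A (Finset.subset_univ I)
  rw [← hm, ← Finset.sum_biUnion hpair]
  exact (hstar m).trans (sum_range_le_sum_of_upward_closed hsub hup hP)

/-- A partition of `[n]` that is not equitable has a low set. -/
theorem IsPartitionOn.exists_low {n k : ℕ} (hdvd : k ∣ n * (n + 1) / 2) {A : Fin k → Finset ℕ}
    (hA : IsPartitionOn n A) (hne : ¬ Equitable n A) : ∃ i, (A i).sum id < magicConst n k := by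
  by_contra! hge
  have htotal : ∑ i, (A i).sum id = ∑ _i : Fin k, magicConst n k := by
    rw [← Finset.sum_biUnion fun i _ j _ hij => hA.1 i j hij, hA.2, Finset.sum_const,
      Finset.card_univ, Fintype.card_fin, smul_eq_mul, magicConst, Nat.mul_div_cancel' hdvd]
    have h : (Finset.Icc 1 n).sum id = ∑ i ∈ Finset.range (n + 1), i := by
      rw [Finset.range_eq_Ico, Finset.sum_eq_sum_Ico_succ_bot (by omega)]
      simp only [id, zero_add]
      rfl
    rw [h, Finset.sum_range_id, Nat.add_sub_cancel, mul_comm]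
  exact hne fun i =>
    ((Finset.sum_eq_sum_iff_of_le fun i _ => hge i).1 htotal.symm i (Finset.mem_univ i)).symm

/-- Parts that are not high and include a low set are not closed under successors in `[n]`. -/
theorem StarCond.exists_succ_notMem {n k : ℕ} {A : Fin k → Finset ℕ} {p : Fin k → ℕ}
    (hstar : StarCond n k p) (hmono : Monotone p) (hA : Implements n A p) {I : Finset (Fin k)}
    (hI : ∀ i ∈ I, (A i).sum id ≤ magicConst n k)
    (hlow : ∃ i ∈ I, (A i).sum id < magicConst n k) :
    ∃ t, ∃ i ∈ I, ∃ j ∉ I, t ∈ A i ∧ t + 1 ∈ A j := by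
  by_contra! h
  refine absurd (hstar.card_mul_le_sum hmono hA (I := I) (hlow.imp fun _ hi => hi.1) ?_)
    (not_le.2 ?_)
  · intro t ht htn
    obtain ⟨i, hi, hti⟩ := Finset.mem_biUnion.1 ht
    have hmem : t + 1 ∈ Finset.univ.biUnion A := hA.1.2 ▸ Finset.mem_Icc.2 ⟨by omega, htn⟩
    obtain ⟨j, -, hj⟩ := Finset.mem_biUnion.1 hmem
    by_contra hnot
    exact h t i hi j (fun hjI => hnot (Finset.mem_biUnion.2 ⟨j, hjI, hj⟩)) hti hj
  · simpa using Finset.sum_lt_sum hI hlow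

/-- Lemma 1. -/
theorem stmt_8 (n k : ℕ) (hn : 0 < n) (hk : 0 < k) (hdvd : k ∣ n * (n + 1) / 2)
    (p : Fin k → ℕ) (hp : ∀ i, 0 < p i) (hmono : Monotone p)
    (hsum : ∑ i : Fin k, p i = n) (hstar : StarCond n k p)
    (hne : ¬ ∃ B : Fin k → Finset ℕ, Implements n B p ∧ Equitable n B)
    (A : Fin k → Finset ℕ) (hA : MinimalPartition n A p) :
    (∃ (t : ℕ) (i j : Fin k), t ∈ A i ∧ t + 1 ∈ A j ∧
      (A i).sum id < magicConst n k ∧ (A j).sum id = magicConst n k) ∧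
    (∃ (s : ℕ) (i j : Fin k), s ∈ A i ∧ s + 1 ∈ A j ∧
      (A i).sum id = magicConst n k ∧ magicConst n k < (A j).sum id) := by
  obtain ⟨i₀, hi₀⟩ := hA.1.1.exists_low hdvd fun h => hne ⟨A, hA.1, h⟩
  constructor
  · obtain ⟨t, i, hi, j, hj, hti, htj⟩ := hstar.exists_succ_notMem hmono hA.1
      (I := Finset.univ.filter fun i => (A i).sum id < magicConst n k)
      (fun i hi => (Finset.mem_filter.1 hi).2.le)
      ⟨i₀, Finset.mem_filter.2 ⟨Finset.mem_univ _, hi₀⟩, hi₀⟩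
    simp only [Finset.mem_filter, Finset.mem_univ, true_and, not_lt] at hi hj
    refine ⟨t, i, j, hti, htj, hi, hj.antisymm' ?_⟩
    exact not_lt.1 fun hj' => hA.not_low_high hti htj hi hj'
  · obtain ⟨t, i, hi, j, hj, hti, htj⟩ := hstar.exists_succ_notMem hmono hA.1
      (I := Finset.univ.filter fun i => (A i).sum id ≤ magicConst n k)
      (fun i hi => (Finset.mem_filter.1 hi).2)
      ⟨i₀, Finset.mem_filter.2 ⟨Finset.mem_univ _, hi₀.le⟩, hi₀⟩
    simp only [Finset.mem_filter, Finset.mem_univ, true_and, not_le] at hi hj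
    refine ⟨t, i, j, hti, htj, hi.antisymm ?_, hj⟩
    exact not_lt.1 fun hi' => hA.not_low_high hti htj hi' hj
end

section
/- Under the Lemma 6 setup (see context), if A₀ = B₀, then Y ∖ {y} contains no element c such that c + 1 ∈ X ∖ {x}. -/
open Finset

/-- Exchanging two elements of distinct parts gives a partition implementing the same sizes. -/
theorem Implements.exists_swap {n k : ℕ} {A : Fin k → Finset ℕ} {p : Fin k → ℕ}
    (h : Implements n A p) {i j : Fin k} (hij : i ≠ j) {a b : ℕ} (ha : a ∈ A i) (hb : b ∈ A j) :
    ∃ B : Fin k → Finset ℕ, Implements n B p ∧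
      (B i).sum id + a = (A i).sum id + b ∧ (B j).sum id + b = (A j).sum id + a ∧
      (∀ l, l ≠ i → l ≠ j → B l = A l) ∧
      ∀ t, t ≠ a → t ≠ b → ∀ l, t ∈ B l ↔ t ∈ A l := by
  obtain ⟨⟨hdisj, hunion⟩, e, he⟩ := h
  have mem_iff : ∀ l t, t ∈ (A l).map (Equiv.swap a b).toEmbedding ↔ Equiv.swap a b t ∈ A l := by
    intro l t
    rw [Finset.mem_map_equiv, Equiv.symm_swap]
  have haj : a ∉ A j := Finset.disjoint_left.mp (hdisj i j hij) ha
  have hbi : b ∉ A i := Finset.disjoint_right.mp (hdisj i j hij) hb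
  have sum_swap : ∀ (S : Finset ℕ) (u v : ℕ), u ∈ S → v ∉ S →
      (S.map (Equiv.swap u v).toEmbedding).sum id + u = S.sum id + v := by
    intro S u v hu hv
    have hrest : ∑ t ∈ S.erase u, Equiv.swap u v t = ∑ t ∈ S.erase u, t := by
      refine Finset.sum_congr rfl fun t ht => ?_
      obtain ⟨htu, htS⟩ := Finset.mem_erase.mp ht
      exact Equiv.swap_apply_of_ne_of_ne htu (ne_of_mem_of_not_mem htS hv)
    have h₁ := Finset.add_sum_erase S (fun t => Equiv.swap u v t) hu
    have h₂ := Finset.add_sum_erase S (fun t => t) hu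
    simp only [Equiv.swap_apply_left] at h₁
    simp only [Finset.sum_map, id, Equiv.coe_toEmbedding]
    omega
  have hmemU : ∀ l t, t ∈ A l → t ∈ Finset.Icc 1 n := fun l t ht =>
    hunion ▸ Finset.mem_biUnion.mpr ⟨l, Finset.mem_univ l, ht⟩
  refine ⟨fun l => (A l).map (Equiv.swap a b).toEmbedding, ⟨⟨?_, ?_⟩, e, ?_⟩, ?_, ?_, ?_, ?_⟩
  · exact fun l m hlm => (Finset.disjoint_map _).mpr (hdisj l m hlm)
  · ext t
    have key : t ∈ Finset.univ.biUnion (fun l => (A l).map (Equiv.swap a b).toEmbedding) ↔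
        Equiv.swap a b t ∈ Finset.univ.biUnion A := by
      simp only [Finset.mem_biUnion, mem_iff]
    rw [key, hunion]
    rcases eq_or_ne t a with rfl | hta
    · rw [Equiv.swap_apply_left]
      exact iff_of_true (hmemU j b hb) (hmemU i t ha)
    rcases eq_or_ne t b with rfl | htb
    · rw [Equiv.swap_apply_right]
      exact iff_of_true (hmemU i a ha) (hmemU j t hb)
    rw [Equiv.swap_apply_of_ne_of_ne hta htb]
  · intro l
    rw [Finset.card_map, he]
  · exact sum_swap _ a b ha hbi
  · rw [Equiv.swap_comm]
    exact sum_swap _ b a hb haj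
  · intro l hli hlj
    have hal : a ∉ A l := Finset.disjoint_left.mp (hdisj i l hli.symm) ha
    have hbl : b ∉ A l := Finset.disjoint_left.mp (hdisj j l hlj.symm) hb
    ext t
    rw [mem_iff]
    rcases eq_or_ne t a with rfl | hta
    · simp [hal, hbl]
    rcases eq_or_ne t b with rfl | htb
    · simp [hal, hbl]
    rw [Equiv.swap_apply_of_ne_of_ne hta htb]
  · intro t hta htb l
    rw [mem_iff, Equiv.swap_apply_of_ne_of_ne hta htb]

/-- The width is at most the gap of any pair from a low and a high part. -/
theorem width_le {n k : ℕ} {A : Fin k → Finset ℕ} {x y : ℕ} {i j : Fin k} (hx : x ∈ A i)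
    (hy : y ∈ A j) (hxy : x < y) (hi : (A i).sum id < magicConst n k)
    (hj : magicConst n k < (A j).sum id) : width n A ≤ ((y - x : ℕ) : ℕ∞) :=
  sInf_le ⟨x, y, i, j, hx, hy, hxy, hi, hj, rfl⟩

/-- If part `0` is low by one, part `1` is high by one and the other two parts are exact, then in a
minimal partition of minimal width the successor of the low end and the predecessor of the high end
of a width-attaining pair can only share a part if they coincide. -/
theorem eq_add_two_of_mem_same_part {n : ℕ} {A : Fin 4 → Finset ℕ} {p : Fin 4 → ℕ}
    (hmin : MinimalPartition n A p)
    (hminw : ∀ B : Fin 4 → Finset ℕ, MinimalPartition n B p → width n A ≤ width n B)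
    (h0 : (A 0).sum id + 1 = magicConst n 4) (h1 : (A 1).sum id = magicConst n 4 + 1)
    (h2 : (A 2).sum id = magicConst n 4) (h3 : (A 3).sum id = magicConst n 4)
    {x y : ℕ} (hx : x ∈ A 0) (hy : y ∈ A 1) (hxy : x < y)
    (hw : width n A = ((y - x : ℕ) : ℕ∞)) {k : Fin 4} (hk : k = 2 ∨ k = 3)
    (hxk : x + 1 ∈ A k) (hyk : y - 1 ∈ A k) : y = x + 2 := by
  by_contra hne
  have hk0 : (0 : Fin 4) ≠ k := by rcases hk with rfl | rfl <;> decide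
  have hk1 : k ≠ 1 := by rcases hk with rfl | rfl <;> decide
  have hdisj := hmin.1.1.1
  have hyx1 : y ≠ x + 1 := by
    rintro rfl
    exact Finset.disjoint_left.mp (hdisj k 1 hk1) hxk hy
  obtain ⟨B, hB, hB0, hBk, hBl, hBt⟩ := hmin.1.exists_swap hk0 hx hxk
  have hB1 : B 1 = A 1 := hBl 1 (by decide) hk1.symm
  have hd : dVal n B = dVal n A := by
    simp only [dVal, Fin.sum_univ_four]
    have e0 : (B 0).sum id = magicConst n 4 := by omega
    rcases hk with rfl | rfl
    · have e3 : B 3 = A 3 := hBl 3 (by decide) (by decide)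
      have e2 : (B 2).sum id = (A 0).sum id := by omega
      rw [e0, e2, e3, hB1, h2]
      ring
    · have e2 : B 2 = A 2 := hBl 2 (by decide) (by decide)
      have e3 : (B 3).sum id = (A 0).sum id := by omega
      rw [e0, e2, e3, hB1, h3]
      ring
  have hAk : (A k).sum id = magicConst n 4 := by rcases hk with rfl | rfl <;> assumption
  have hle := hminw B ⟨hB, fun C hC => hd ▸ hmin.2 C hC⟩
  have hyB : y - 1 ∈ B k := (hBt _ (by omega) (by omega) k).mpr hyk
  have hw' := hle.trans (width_le hyB (hB1 ▸ hy) (by omega) (by omega) (by rw [hB1]; omega))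
  rw [hw, Nat.cast_le] at hw'
  omega

/-- In a minimal partition whose part `0` is low by one and whose part `1` is high by one, a pair
`x`, `x + 2` split between these parts excludes a disjoint pair `c + 1`, `c`. -/
theorem add_one_eq_of_mem_of_mem {n : ℕ} {A : Fin 4 → Finset ℕ} {p : Fin 4 → ℕ}
    (hmin : MinimalPartition n A p)
    (h0 : (A 0).sum id + 1 = magicConst n 4) (h1 : (A 1).sum id = magicConst n 4 + 1)
    (h2 : (A 2).sum id = magicConst n 4) (h3 : (A 3).sum id = magicConst n 4)
    {x : ℕ} (hx : x ∈ A 0) (hy : x + 2 ∈ A 1) {c : ℕ} (hc : c ∈ A 1) (hcy : c ≠ x + 2)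
    (hcX : c + 1 ∈ A 0) : c + 1 = x := by
  by_contra hcx
  have hdisj := Finset.disjoint_left.mp (hmin.1.1.1 0 1 (by decide))
  have hxc : c ≠ x := by
    rintro rfl
    exact hdisj hx hc
  have hyc : c + 1 ≠ x + 2 := fun h => hdisj (h ▸ hcX) hy
  obtain ⟨B, hB, hB0, hB1, hBl, hBt⟩ := hmin.1.exists_swap (by decide) hx hy
  obtain ⟨C, hC, hC0, hC1, hCl, -⟩ := hB.exists_swap (i := 0) (j := 1) (by decide)
    ((hBt _ hcx hyc 0).mpr hcX) ((hBt _ hxc hcy 1).mpr hc)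
  have hC2 : C 2 = A 2 := by
    rw [hCl 2 (by decide) (by decide), hBl 2 (by decide) (by decide)]
  have hC3 : C 3 = A 3 := by
    rw [hCl 3 (by decide) (by decide), hBl 3 (by decide) (by decide)]
  have e0 : (C 0).sum id = magicConst n 4 := by omega
  have e1 : (C 1).sum id = magicConst n 4 := by omega
  have hle := hmin.2 C hC
  simp only [dVal, Fin.sum_univ_four, hC2, hC3, e0, e1, h1, h2, h3, ← h0] at hle
  push_cast at hle
  ring_nf at hle
  omega

/-- Lemma 6(vi). -/
theorem stmt_18 (n : ℕ) (hn : 0 < n) (hdvd : 4 ∣ n * (n + 1) / 2)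
    (p : Fin 4 → ℕ) (hp : ∀ i, 0 < p i)
    (X Y Z W : Finset ℕ)
    (hmin : MinimalPartition n ![X, Y, Z, W] p)
    (hminw : ∀ B : Fin 4 → Finset ℕ, MinimalPartition n B p →
      width n ![X, Y, Z, W] ≤ width n B)
    (hfin : width n ![X, Y, Z, W] ≠ ⊤)
    (hX : X.sum id + 1 = magicConst n 4)
    (hY : Y.sum id = magicConst n 4 + 1)
    (hZ : Z.sum id = magicConst n 4) (hW : W.sum id = magicConst n 4)
    (x y : ℕ) (hx : x ∈ X) (hy : y ∈ Y) (hxy : x < y)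
    (hw : width n ![X, Y, Z, W] = ((y - x : ℕ) : ℕ∞))
    (A₀ B₀ : Finset ℕ) (hA₀ : A₀ = Z ∨ A₀ = W) (hB₀ : B₀ = Z ∨ B₀ = W)
    (hxA : x + 1 ∈ A₀) (hyB : y - 1 ∈ B₀) :
    A₀ = B₀ → ∀ c : ℕ, c ∈ Y → c ≠ y → c + 1 ∈ X → c + 1 = x := by
  rintro rfl c hc hcy hcX
  obtain ⟨k, hk, rfl⟩ : ∃ k : Fin 4, (k = 2 ∨ k = 3) ∧ A₀ = ![X, Y, Z, W] k := by
    rcases hA₀ with h | h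
    · exact ⟨2, Or.inl rfl, h⟩
    · exact ⟨3, Or.inr rfl, h⟩
  obtain rfl := eq_add_two_of_mem_same_part hmin hminw hX hY hZ hW hx hy hxy hw hk hxA hyB
  exact add_one_eq_of_mem_of_mem hmin hX hY hZ hW hx hy hc hcy hcX
end
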